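/- Let (Γ, p) be an enriched graph, V_{Γ,p} ⊆ ℝ^{E(Γ)} the linear subspace given by the equations x_e = x_{e'} for e ∼_p e', and θ_{Γ,p} : V_{Γ,p} → ℝ^{E(Γ)_p} the linear map defined in coordinates by y_{[e]_p} = x_e − x_{e'} whenever [e']_p and [e]_p are consecutive classes with e' ≼_p e, and y_{[e]_p} = x_e when [e]_p is a minimal class. Then θ_{Γ,p} is a linear isomorphism and θ_{Γ,p}(K(Γ, p)) = ℝ^{E(Γ)_p}_{>0}. -/

import Mathlib

/-- A finite multigraph: finitely many vertices and edges, each edge has two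
(ordered, possibly equal) endpoints; loops and multiple edges are allowed. -/
structure Multigraph where
  V : Type
  E : Type
  [finV : Finite V]
  [finE : Finite E]
  fst : E → V
  snd : E → V

attribute [instance] Multigraph.finV Multigraph.finE

namespace Multigraph

variable (Γ : Multigraph)

/-- `v` is an endpoint of the edge `e`. -/
def Inc (v : Γ.V) (e : Γ.E) : Prop := Γ.fst e = v ∨ Γ.snd e = v

/-- `e` is a loop. -/
def IsLoop (e : Γ.E) : Prop := Γ.fst e = Γ.snd e

/-- Adjacency inside the induced subgraph on the vertex set `W`. -/
def AdjOn (W : Set Γ.V) (a b : Γ.V) : Prop :=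
  a ∈ W ∧ b ∈ W ∧ ∃ e : Γ.E, (Γ.fst e = a ∧ Γ.snd e = b) ∨ (Γ.fst e = b ∧ Γ.snd e = a)

/-- The induced subgraph on `W` is (nonempty and) connected. -/
def ConnectedOn (W : Set Γ.V) : Prop :=
  W.Nonempty ∧ ∀ a ∈ W, ∀ b ∈ W, Relation.ReflTransGen (Γ.AdjOn W) a b

/-- `Γ` is connected. -/
def Connected : Prop := Γ.ConnectedOn Set.univ

/-- A separating vertex: its removal disconnects the graph; moreover a vertex
carrying a loop is separating provided at least one other edge is attached to it. -/
def SeparatingVertex (v : Γ.V) : Prop :=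
  ({w : Γ.V | w ≠ v}.Nonempty ∧ ¬ Γ.ConnectedOn {w : Γ.V | w ≠ v}) ∨
  (∃ e₁ e₂ : Γ.E, e₁ ≠ e₂ ∧ Γ.IsLoop e₁ ∧ Γ.Inc v e₁ ∧ Γ.Inc v e₂)

/-- `Γ` is biconnected: connected and without separating vertices. -/
def Biconnected : Prop := Γ.Connected ∧ ∀ v : Γ.V, ¬ Γ.SeparatingVertex v

/-- The set `E(W, Wᶜ)` of edges joining a vertex of `W` to a vertex outside `W` (a *cut*). -/
def crossEdges (W : Set Γ.V) : Set Γ.E :=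
  {e | (Γ.fst e ∈ W ∧ Γ.snd e ∉ W) ∨ (Γ.snd e ∈ W ∧ Γ.fst e ∉ W)}

/-- `W` determines a bond: a nontrivial partition `W ∪ Wᶜ` with both induced subgraphs
connected. -/
def IsBondOn (W : Set Γ.V) : Prop :=
  W.Nonempty ∧ Wᶜ.Nonempty ∧ Γ.ConnectedOn W ∧ Γ.ConnectedOn Wᶜ

/-- A bond: a minimal cut. -/
def IsBond (B : Set Γ.E) : Prop := ∃ W : Set Γ.V, Γ.IsBondOn W ∧ B = Γ.crossEdges W

/-- The subgraph consisting of the edges in `F` together with their endpoints. -/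
def edgeSubgraph (F : Set Γ.E) : Multigraph where
  V := {v : Γ.V // ∃ e ∈ F, Γ.Inc v e}
  E := {e : Γ.E // e ∈ F}
  fst := fun e => ⟨Γ.fst e.1, e.1, e.2, Or.inl rfl⟩
  snd := fun e => ⟨Γ.snd e.1, e.1, e.2, Or.inr rfl⟩

/-- A biconnected component: a maximal set of edges inducing a biconnected subgraph. -/
def IsBicomponent (F : Set Γ.E) : Prop :=
  (Γ.edgeSubgraph F).Biconnected ∧
    ∀ F' : Set Γ.E, F ⊆ F' → (Γ.edgeSubgraph F').Biconnected → F' = F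

/-- The contraction `Γ/S` of `Γ`: all the edges in `S` are contracted; the remaining
edges are `E(Γ) \ S`. -/
def contract (S : Set Γ.E) : Multigraph where
  V := Quot (fun a b : Γ.V => ∃ e ∈ S, Γ.fst e = a ∧ Γ.snd e = b)
  E := {e : Γ.E // e ∉ S}
  fst := fun e => Quot.mk _ (Γ.fst e.1)
  snd := fun e => Quot.mk _ (Γ.snd e.1)

/-- Enriched graphs (Abreu–Pacini): `p` is an enriched structure on `Γ`, i.e. a
preorder on the edges satisfying the recursive conditions (1), (2), (3). -/
inductive IsEnriched : ∀ G : Multigraph, (G.E → G.E → Prop) → Prop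
  | of_subsingleton (G : Multigraph) (p : G.E → G.E → Prop)
      (hrefl : Reflexive p) (htrans : Transitive p) (hsub : Subsingleton G.E) :
      IsEnriched G p
  | of_biconnected (G : Multigraph) (p : G.E → G.E → Prop)
      (hrefl : Reflexive p) (htrans : Transitive p)
      (hbic : G.Biconnected) (S : Set G.E) (hne : S.Nonempty)
      (hlow : ∀ e e' : G.E, p e e' → e' ∈ S → e ∈ S)
      (hmin : ∀ e ∈ S, ∀ e' : G.E, p e e')
      (hrec : IsEnriched (G.contract S) (fun a b => p a.1 b.1)) :
      IsEnriched G p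
  | of_separating (G : Multigraph) (p : G.E → G.E → Prop)
      (hrefl : Reflexive p) (htrans : Transitive p)
      (hsep : ∃ v : G.V, G.SeparatingVertex v)
      (hcomp : ∀ F : Set G.E, G.IsBicomponent F →
        IsEnriched (G.edgeSubgraph F) (fun a b => p a.1 b.1))
      (hincomp : ∀ F F' : Set G.E, G.IsBicomponent F → G.IsBicomponent F' → F ≠ F' →
        ∀ e ∈ F, ∀ e' ∈ F', ¬ p e e') :
      IsEnriched G p

/-- `a ∼ₚ b`. -/
def Esim (p : Γ.E → Γ.E → Prop) (a b : Γ.E) : Prop := p a b ∧ p b a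

/-- `a <ₚ b`. -/
def StrictBelow (p : Γ.E → Γ.E → Prop) (a b : Γ.E) : Prop := p a b ∧ ¬ p b a

/-- The classes of `a` and `b` are consecutive (with `a` below `b`). -/
def Consecutive (p : Γ.E → Γ.E → Prop) (a b : Γ.E) : Prop :=
  StrictBelow Γ p a b ∧ ∀ c : Γ.E, ¬ (StrictBelow Γ p a c ∧ StrictBelow Γ p c b)

/-- The specialization `(Γ, p) ⇝ (Γ, p')` (same underlying graph, `S = ∅`). -/
def SpecializesSame (p p' : Γ.E → Γ.E → Prop) : Prop :=
  IsEnriched Γ p ∧ IsEnriched Γ p' ∧ ∀ e e' : Γ.E, p e e' → p' e e'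

/-- The specialization `(Γ, p) ⇝ (Γ/S, p')`. -/
def Specializes (p : Γ.E → Γ.E → Prop) (S : Set Γ.E)
    (p' : (Γ.contract S).E → (Γ.contract S).E → Prop) : Prop :=
  IsEnriched Γ p ∧ IsEnriched (Γ.contract S) p' ∧
  (∀ e e' : Γ.E, p e e' → e' ∈ S → e ∈ S) ∧
  (∀ (e e' : Γ.E) (he : e ∉ S) (he' : e' ∉ S), p e e' → p' ⟨e, he⟩ ⟨e', he'⟩)

/-- A simple specialization `(Γ, p) ⇝ (Γ, p')`: it merges two consecutive classes. -/
def IsSimpleSpec (p p' : Γ.E → Γ.E → Prop) : Prop :=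
  SpecializesSame Γ p p' ∧ ∃ e₁ e₂ : Γ.E, Consecutive Γ p e₁ e₂ ∧
    ∀ e e' : Γ.E, p' e e' ↔ p e e' ∨
      ((Esim Γ p e e₁ ∨ Esim Γ p e e₂) ∧ (Esim Γ p e' e₁ ∨ Esim Γ p e' e₂))

/-- `rank(p)`: the number of equivalence classes of edges. -/
noncomputable def rank (p : Γ.E → Γ.E → Prop) : ℕ := Nat.card (Quot (Esim Γ p))

/-- The (relatively open) cone `K(Γ, p) ⊆ ℝ^{E(Γ)}`. -/
def K (p : Γ.E → Γ.E → Prop) : Set (Γ.E → ℝ) :=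
  {x | (∀ e, 0 < x e) ∧ ∀ e e' : Γ.E, p e e' → x e ≤ x e' ∧ (x e = x e' ↔ p e' e)}

open Classical in
/-- The injective linear map `ī : ℝ^{E(Γ/S)} → ℝ^{E(Γ)}` (extension by zero). -/
noncomputable def extendZero (S : Set Γ.E) (y : (Γ.contract S).E → ℝ) : Γ.E → ℝ :=
  fun e => if h : e ∈ S then 0 else y ⟨e, h⟩

end Multigraph

/-- A face of a closed convex cone `σ`: either `σ` itself, or `σ ∩ ker ℓ` for a linear
functional `ℓ` which is nonnegative on `σ`. -/
def IsFaceOf {α : Type} (σ F : Set (α → ℝ)) : Prop :=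
  F = σ ∨ ∃ ℓ : (α → ℝ) →ₗ[ℝ] ℝ, (∀ x ∈ σ, 0 ≤ ℓ x) ∧ F = σ ∩ {x | ℓ x = 0}

/-- The subspace `V_{Γ,p} ⊆ ℝ^{E(Γ)}` cut out by the equations `x e = x e'` for
`e ∼ₚ e'`. -/
def Multigraph.Vset (Γ : Multigraph) (p : Γ.E → Γ.E → Prop) : Set (Γ.E → ℝ) :=
  {x | ∀ e e' : Γ.E, p e e' → p e' e → x e = x e'}

/-- `θ` satisfies the defining property of `θ_{Γ,p}` on `V_{Γ,p}`: the coordinate of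
`θ x` at a class `[e]ₚ` is `x e` if `[e]ₚ` is minimal, and `x e − x e'` if `[e']ₚ` is the
consecutive class below `[e]ₚ`. -/
def Multigraph.IsThetaSpec (Γ : Multigraph) (p : Γ.E → Γ.E → Prop)
    (θ : (Γ.E → ℝ) → (Quot (Multigraph.Esim Γ p) → ℝ)) : Prop :=
  ∀ x ∈ Multigraph.Vset Γ p, ∀ e : Γ.E,
    ((∀ f : Γ.E, p f e → p e f) → θ x (Quot.mk (Multigraph.Esim Γ p) e) = x e) ∧
    (∀ e' : Γ.E, Multigraph.Consecutive Γ p e' e →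
      θ x (Quot.mk (Multigraph.Esim Γ p) e) = x e - x e')

namespace Multigraph

/-- The subgraph spanned by a single edge is biconnected. -/
theorem biconnected_edgeSubgraph_singleton (Γ : Multigraph) (e : Γ.E) :
    (Γ.edgeSubgraph {e}).Biconnected := by
  have hsub : ∀ f g : (Γ.edgeSubgraph {e}).E, f = g := by
    rintro ⟨f, hf⟩ ⟨g, hg⟩
    exact Subtype.ext (hf.trans hg.symm)
  let e₀ : (Γ.edgeSubgraph {e}).E := ⟨e, rfl⟩
  have hv : ∀ v : (Γ.edgeSubgraph {e}).V,
      v = (Γ.edgeSubgraph {e}).fst e₀ ∨ v = (Γ.edgeSubgraph {e}).snd e₀ := by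
    rintro ⟨v, f, hf, hinc⟩
    obtain rfl : f = e := hf
    exact hinc.imp (fun h => Subtype.ext h.symm) (fun h => Subtype.ext h.symm)
  refine ⟨⟨⟨(Γ.edgeSubgraph {e}).fst e₀, trivial⟩, fun a _ b _ => ?_⟩, fun v hsep => ?_⟩
  · rcases hv a with ha | ha <;> rcases hv b with hb | hb
    · rw [ha, hb]
    · exact .single ⟨trivial, trivial, e₀, Or.inl ⟨ha.symm, hb.symm⟩⟩
    · exact .single ⟨trivial, trivial, e₀, Or.inr ⟨hb.symm, ha.symm⟩⟩
    · rw [ha, hb]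
  · rcases hsep with ⟨hne, hcon⟩ | ⟨e₁, e₂, hne, -⟩
    · refine hcon ⟨hne, fun a ha b hb => ?_⟩
      have hab : a = b := by
        have ha' : a ≠ v := ha
        have hb' : b ≠ v := hb
        have h₁ := hv a
        have h₂ := hv b
        have h₃ := hv v
        grind
      rw [hab]
    · exact hne (hsub _ _)

/-- Every edge lies in a biconnected component. -/
theorem exists_isBicomponent_mem (Γ : Multigraph) (e : Γ.E) :
    ∃ F : Set Γ.E, Γ.IsBicomponent F ∧ e ∈ F := by
  obtain ⟨F, heF, hF⟩ := Set.Finite.exists_le_maximal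
    (s := {F : Set Γ.E | (Γ.edgeSubgraph F).Biconnected}) (Set.toFinite _)
    (Γ.biconnected_edgeSubgraph_singleton e)
  exact ⟨F, ⟨hF.1, fun F' hFF' hF' => (hF.eq_of_le hF' hFF').symm⟩, heF rfl⟩

theorem IsEnriched.refl {Γ : Multigraph} {p : Γ.E → Γ.E → Prop} (h : IsEnriched Γ p) (e : Γ.E) :
    p e e := by
  cases h <;> apply_assumption

theorem IsEnriched.trans {Γ : Multigraph} {p : Γ.E → Γ.E → Prop} (h : IsEnriched Γ p)
    {a b c : Γ.E} (hab : p a b) (hbc : p b c) : p a c := by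
  cases h with
  | of_subsingleton _ _ _ htrans => exact htrans hab hbc
  | of_biconnected _ _ _ htrans => exact htrans hab hbc
  | of_separating _ _ _ htrans => exact htrans hab hbc

/-- The edges below a given edge of an enriched graph form a chain. -/
theorem IsEnriched.total_below {Γ : Multigraph} {p : Γ.E → Γ.E → Prop} (h : IsEnriched Γ p)
    {a b c : Γ.E} (hac : p a c) (hbc : p b c) : p a b ∨ p b a := by
  induction h with
  | of_subsingleton G p hrefl _ hsub => exact Or.inl (Subsingleton.elim a b ▸ hrefl a)
  | of_biconnected G p _ _ _ S _ hlow hmin _ ih =>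
    by_cases ha : a ∈ S
    · exact Or.inl (hmin a ha b)
    by_cases hb : b ∈ S
    · exact Or.inr (hmin b hb a)
    have hc : c ∉ S := fun hc => ha (hlow a c hac hc)
    exact ih (a := ⟨a, ha⟩) (b := ⟨b, hb⟩) (c := ⟨c, hc⟩) hac hbc
  | of_separating G p _ _ _ _ hincomp ih =>
    obtain ⟨F, hF, hc⟩ := G.exists_isBicomponent_mem c
    have hmem : ∀ d, p d c → d ∈ F := by
      intro d hd
      obtain ⟨F', hF', hd'⟩ := G.exists_isBicomponent_mem d
      by_cases hFF : F' = F
      · exact hFF ▸ hd'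
      · exact absurd hd (hincomp F' F hF' hF hFF d hd' c hc)
    exact ih F hF (a := ⟨a, hmem a hac⟩) (b := ⟨b, hmem b hbc⟩) (c := ⟨c, hc⟩) hac hbc

section

variable {Γ : Multigraph} {p : Γ.E → Γ.E → Prop}

theorem IsEnriched.esim_equivalence (h : IsEnriched Γ p) : Equivalence (Esim Γ p) :=
  ⟨fun e => ⟨h.refl e, h.refl e⟩, fun hab => ⟨hab.2, hab.1⟩,
    fun hab hbc => ⟨h.trans hab.1 hbc.1, h.trans hbc.2 hab.2⟩⟩

theorem IsEnriched.quot_mk_eq_iff (h : IsEnriched Γ p) {a b : Γ.E} :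
    Quot.mk (Esim Γ p) a = Quot.mk (Esim Γ p) b ↔ Esim Γ p a b :=
  ⟨fun hab => h.esim_equivalence.eqvGen_iff.1 (Quot.eqvGen_exact hab), fun hab => Quot.sound hab⟩

theorem IsEnriched.esim_out (h : IsEnriched Γ p) (e : Γ.E) :
    Esim Γ p (Quot.mk (Esim Γ p) e).out e :=
  h.quot_mk_eq_iff.1 (Quot.out_eq _)

theorem IsEnriched.wellFounded_strictBelow (h : IsEnriched Γ p) :
    WellFounded (StrictBelow Γ p) := by
  have : IsTrans Γ.E (StrictBelow Γ p) :=
    ⟨fun _ _ _ hab hbc => ⟨h.trans hab.1 hbc.1, fun hca => hbc.2 (h.trans hca hab.1)⟩⟩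
  have : Std.Irrefl (StrictBelow Γ p) := ⟨fun _ ha => ha.2 ha.1⟩
  exact Finite.wellFounded_of_trans_of_irrefl _

/-- A class that is not minimal has a consecutive class below it. -/
theorem IsEnriched.exists_consecutive (h : IsEnriched Γ p) {e : Γ.E}
    (he : ¬ ∀ f : Γ.E, p f e → p e f) : ∃ e', Consecutive Γ p e' e := by
  push Not at he
  obtain ⟨f, hfe, hef⟩ := he
  have : IsTrans Γ.E (Function.swap (StrictBelow Γ p)) :=
    ⟨fun _ _ _ hab hbc => ⟨h.trans hbc.1 hab.1, fun hca => hab.2 (h.trans hca hbc.1)⟩⟩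
  have : Std.Irrefl (Function.swap (StrictBelow Γ p)) := ⟨fun _ ha => ha.2 ha.1⟩
  obtain ⟨m, hm, hmax⟩ := (Finite.wellFounded_of_trans_of_irrefl
    (Function.swap (StrictBelow Γ p))).has_min {a | StrictBelow Γ p a e} ⟨f, hfe, hef⟩
  exact ⟨m, hm, fun c hc => hmax c hc.2 hc.1⟩

/-- The consecutive class below a given class is unique. -/
theorem IsEnriched.consecutive_unique (h : IsEnriched Γ p) {a b e e' : Γ.E}
    (ha : Consecutive Γ p a e) (hb : Consecutive Γ p b e') (hee : Esim Γ p e e') :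
    Esim Γ p a b := by
  have hae' : StrictBelow Γ p a e' :=
    ⟨h.trans ha.1.1 hee.1, fun hea => ha.1.2 (h.trans hee.1 hea)⟩
  have hbe : StrictBelow Γ p b e :=
    ⟨h.trans hb.1.1 hee.2, fun heb => hb.1.2 (h.trans hee.2 heb)⟩
  have h₁ := ha.2 b
  have h₂ := hb.2 a
  have h₃ := h.total_below ha.1.1 hbe.1
  unfold StrictBelow at *
  unfold Esim
  tauto

theorem IsEnriched.exists_theta (h : IsEnriched Γ p) :
    ∃ θ : (Γ.E → ℝ) →ₗ[ℝ] (Quot (Esim Γ p) → ℝ), IsThetaSpec Γ p θ := by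
  have hcoord : ∀ q : Quot (Esim Γ p), ∃ ℓ : (Γ.E → ℝ) →ₗ[ℝ] ℝ,
      ((∀ f : Γ.E, p f q.out → p q.out f) → ℓ = LinearMap.proj q.out) ∧
      ((¬ ∀ f : Γ.E, p f q.out → p q.out f) → ∃ e', Consecutive Γ p e' q.out ∧
        ℓ = LinearMap.proj (R := ℝ) (φ := fun _ => ℝ) q.out - LinearMap.proj e') := by
    intro q
    by_cases hq : ∀ f : Γ.E, p f q.out → p q.out f
    · exact ⟨_, fun _ => rfl, fun hn => absurd hq hn⟩
    · obtain ⟨e', he'⟩ := h.exists_consecutive hq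
      exact ⟨_, fun hn => absurd hn hq, fun _ => ⟨e', he', rfl⟩⟩
  choose ℓ hmin hcons using hcoord
  refine ⟨LinearMap.pi ℓ, fun x hx e => ?_⟩
  have ho := h.esim_out e
  have hxo := hx _ _ ho.1 ho.2
  refine ⟨fun he => ?_, fun e' he' => ?_⟩
  · rw [LinearMap.pi_apply, hmin _ fun f hf => h.trans ho.1 (he f (h.trans hf ho.1))]
    exact hxo
  · obtain ⟨d, hd, hℓ⟩ := hcons (Quot.mk _ e) fun hm =>
      he'.1.2 (h.trans ho.2 (hm e' (h.trans he'.1.1 ho.2)))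
    have hde := h.consecutive_unique hd he' ho
    rw [LinearMap.pi_apply, hℓ, LinearMap.sub_apply, LinearMap.proj_apply, LinearMap.proj_apply,
      hxo, hx _ _ hde.1 hde.2]

theorem K_subset_Vset : K Γ p ⊆ Vset Γ p :=
  fun _ hx e e' hee' he'e => (hx.2 e e' hee').2.2 he'e

theorem IsEnriched.theta_injOn (h : IsEnriched Γ p)
    {θ : (Γ.E → ℝ) → (Quot (Esim Γ p) → ℝ)} (hθ : IsThetaSpec Γ p θ) :
    Set.InjOn θ (Vset Γ p) := by
  intro x hx y hy hxy
  funext e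
  induction e using h.wellFounded_strictBelow.induction with
  | _ e ih =>
    have hq := congrFun hxy (Quot.mk _ e)
    by_cases he : ∀ f : Γ.E, p f e → p e f
    · rwa [(hθ x hx e).1 he, (hθ y hy e).1 he] at hq
    · obtain ⟨e', he'⟩ := h.exists_consecutive he
      rw [(hθ x hx e).2 e' he', (hθ y hy e).2 e' he', ih e' he'.1] at hq
      exact sub_left_injective hq

theorem IsEnriched.theta_pos (h : IsEnriched Γ p)
    {θ : (Γ.E → ℝ) → (Quot (Esim Γ p) → ℝ)} (hθ : IsThetaSpec Γ p θ)
    {x : Γ.E → ℝ} (hx : x ∈ K Γ p) (q : Quot (Esim Γ p)) : 0 < θ x q := by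
  induction q using Quot.ind with
  | mk e =>
    have hV := K_subset_Vset hx
    by_cases he : ∀ f : Γ.E, p f e → p e f
    · rw [(hθ x hV e).1 he]
      exact hx.1 e
    · obtain ⟨e', he'⟩ := h.exists_consecutive he
      rw [(hθ x hV e).2 e' he', sub_pos]
      have hle := hx.2 e' e he'.1.1
      exact lt_of_le_of_ne hle.1 fun heq => he'.1.2 (hle.2.1 heq)

open Classical in
/-- The classes below the edge `e`. -/
noncomputable def classesBelow (p : Γ.E → Γ.E → Prop) (e : Γ.E) :
    Finset (Quot (Esim Γ p)) :=
  have := Fintype.ofFinite (Quot (Esim Γ p))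
  {q | p q.out e}

theorem mem_classesBelow {q : Quot (Esim Γ p)} {e : Γ.E} :
    q ∈ classesBelow p e ↔ p q.out e := by
  simp [classesBelow]

theorem IsEnriched.mk_mem_classesBelow (h : IsEnriched Γ p) {a e : Γ.E} :
    Quot.mk _ a ∈ classesBelow p e ↔ p a e := by
  rw [mem_classesBelow]
  exact ⟨h.trans (h.esim_out a).2, h.trans (h.esim_out a).1⟩

theorem IsEnriched.classesBelow_subset (h : IsEnriched Γ p) {a b : Γ.E} (hab : p a b) :
    classesBelow p a ⊆ classesBelow p b := fun _ hq =>
  mem_classesBelow.2 (h.trans (mem_classesBelow.1 hq) hab)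

theorem IsEnriched.classesBelow_of_minimal (h : IsEnriched Γ p) {e : Γ.E}
    (he : ∀ f : Γ.E, p f e → p e f) : classesBelow p e = {Quot.mk _ e} := by
  ext q
  induction q using Quot.ind with
  | mk a =>
    rw [h.mk_mem_classesBelow, Finset.mem_singleton, h.quot_mk_eq_iff]
    exact ⟨fun hae => ⟨hae, he a hae⟩, fun hae => hae.1⟩

theorem IsEnriched.classesBelow_of_consecutive (h : IsEnriched Γ p) {e e' : Γ.E}
    (he : Consecutive Γ p e' e) (hmem : Quot.mk _ e ∉ classesBelow p e') :
    classesBelow p e = Finset.cons (Quot.mk _ e) (classesBelow p e') hmem := by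
  ext q
  induction q using Quot.ind with
  | mk a =>
    rw [h.mk_mem_classesBelow, Finset.mem_cons, h.quot_mk_eq_iff, h.mk_mem_classesBelow]
    constructor
    · intro hae
      have h₁ := he.2 a
      have h₂ := h.total_below hae he.1.1
      unfold StrictBelow at h₁
      unfold Esim
      tauto
    · rintro (hae | hae)
      · exact hae.1
      · exact h.trans hae he.1.1

/-- The vector whose coordinate at `e` is the sum of the `y q` over the classes `q` below `e`. -/
noncomputable def sumBelow (p : Γ.E → Γ.E → Prop) (y : Quot (Esim Γ p) → ℝ) (e : Γ.E) : ℝ :=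
  ∑ q ∈ classesBelow p e, y q

theorem IsEnriched.sumBelow_mem_Vset (h : IsEnriched Γ p) (y : Quot (Esim Γ p) → ℝ) :
    sumBelow p y ∈ Vset Γ p := fun _ _ hab hba => by
  rw [sumBelow, sumBelow,
    Finset.Subset.antisymm (h.classesBelow_subset hab) (h.classesBelow_subset hba)]

theorem IsEnriched.theta_sumBelow (h : IsEnriched Γ p)
    {θ : (Γ.E → ℝ) → (Quot (Esim Γ p) → ℝ)} (hθ : IsThetaSpec Γ p θ)
    (y : Quot (Esim Γ p) → ℝ) : θ (sumBelow p y) = y := by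
  funext q
  induction q using Quot.ind with
  | mk e =>
    have hV := hθ _ (h.sumBelow_mem_Vset y) e
    by_cases he : ∀ f : Γ.E, p f e → p e f
    · rw [hV.1 he, sumBelow, h.classesBelow_of_minimal he, Finset.sum_singleton]
    · obtain ⟨e', he'⟩ := h.exists_consecutive he
      have hmem : Quot.mk _ e ∉ classesBelow p e' := fun hm =>
        he'.1.2 (h.mk_mem_classesBelow.1 hm)
      rw [hV.2 e' he', sumBelow, sumBelow, h.classesBelow_of_consecutive he' hmem,
        Finset.sum_cons, add_sub_cancel_right]

theorem IsEnriched.sumBelow_mem_K (h : IsEnriched Γ p) {y : Quot (Esim Γ p) → ℝ}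
    (hy : ∀ q, 0 < y q) : sumBelow p y ∈ K Γ p := by
  refine ⟨fun e => Finset.sum_pos (fun q _ => hy q)
    ⟨Quot.mk _ e, h.mk_mem_classesBelow.2 (h.refl e)⟩, fun a b hab => ⟨?_, ?_, ?_⟩⟩
  · exact Finset.sum_le_sum_of_subset_of_nonneg (h.classesBelow_subset hab)
      fun q _ _ => (hy q).le
  · intro heq
    by_contra hba
    exact heq.not_lt (Finset.sum_lt_sum_of_subset (h.classesBelow_subset hab)
      (h.mk_mem_classesBelow.2 (h.refl b)) (fun hm => hba (h.mk_mem_classesBelow.1 hm))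
      (hy _) fun q _ _ => (hy q).le)
  · exact fun hba => h.sumBelow_mem_Vset y a b hab hba

end

end Multigraph

/-- Lemma 4.1: the map `θ_{Γ,p} : V_{Γ,p} → ℝ^{E(Γ)ₚ}` exists, and
any linear map satisfying its defining property restricts to a bijection from `V_{Γ,p}`
onto `ℝ^{E(Γ)ₚ}` and maps `K(Γ, p)` onto the open positive orthant `ℝ^{E(Γ)ₚ}_{>0}`. -/
theorem theta_iso_and_image (Γ : Multigraph) (p : Γ.E → Γ.E → Prop)
    (h : Multigraph.IsEnriched Γ p) :
    (∃ θ : (Γ.E → ℝ) →ₗ[ℝ] (Quot (Multigraph.Esim Γ p) → ℝ),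
      Multigraph.IsThetaSpec Γ p θ) ∧
    (∀ θ : (Γ.E → ℝ) →ₗ[ℝ] (Quot (Multigraph.Esim Γ p) → ℝ),
      Multigraph.IsThetaSpec Γ p θ →
      Set.BijOn θ (Multigraph.Vset Γ p) Set.univ ∧
      θ '' Multigraph.K Γ p = {y : Quot (Multigraph.Esim Γ p) → ℝ | ∀ q, 0 < y q}) := by
  refine ⟨h.exists_theta, fun θ hθ => ⟨⟨fun _ _ => trivial, h.theta_injOn hθ, fun y _ =>
    ⟨_, h.sumBelow_mem_Vset y, h.theta_sumBelow hθ y⟩⟩, Set.Subset.antisymm ?_ fun y hy =>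
    ⟨_, h.sumBelow_mem_K hy, h.theta_sumBelow hθ y⟩⟩⟩
  rintro _ ⟨x, hx, rfl⟩
  exact h.theta_pos hθ hx
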